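/- Let (X,d_ℓ,μ_ℓ) be the cable system of a connected, locally finite, simple graph with a complete length function ℓ, with Dirichlet energy D, and let F^ℓ denote the closure, in the norm (D(h,h)+‖h‖²_{L²(μ_ℓ)})^{1/2}, of the set of absolutely continuous, compactly supported, finite-energy functions on X. Then for every nonnegative f ∈ F^ℓ and every nonnegative absolutely continuous g : X → ℝ with D(g,g) < ∞, the pointwise minimum f ∧ g belongs to F^ℓ. -/

import Mathlib

open MeasureTheory Set Metric Filter
open scoped ENNReal NNReal

noncomputable section

variable {V : Type*} {X : Type*}

/-- A *distortion function*: a homeomorphism of `[0,∞)` onto itself. -/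
def IsDistortion (η : ℝ → ℝ) : Prop :=
  StrictMonoOn η (Set.Ici 0) ∧ ContinuousOn η (Set.Ici 0) ∧ η 0 = 0 ∧
    Set.MapsTo η (Set.Ici 0) (Set.Ici 0) ∧ Set.SurjOn η (Set.Ici 0) (Set.Ici 0)

/-- Two distance functions on the same set are *quasisymmetric* if the identity map is an
`η`-quasisymmetry for some distortion function `η`. -/
def QSPair {A : Type*} (d₁ d₂ : A → A → ℝ) : Prop :=
  ∃ η : ℝ → ℝ, IsDistortion η ∧
    ∀ x a b : A, x ≠ b → d₂ x a / d₂ x b ≤ η (d₁ x a / d₁ x b)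

/-- A graph has polynomial growth with volume growth exponent `d`:
`C⁻¹ r^d ≤ |B_G(x,r)| ≤ C r^d` for all vertices `x` and all `r ≥ 1`. -/
def HasPolynomialGrowth (G : SimpleGraph V) (d : ℝ) : Prop :=
  ∃ C : ℝ, 1 < C ∧ ∀ (x : V) (r : ℝ), 1 ≤ r →
    C⁻¹ * r ^ d ≤ (Nat.card {y : V | (G.dist x y : ℝ) < r} : ℝ) ∧
    (Nat.card {y : V | (G.dist x y : ℝ) < r} : ℝ) ≤ C * r ^ d

/-- `IsCableSystem G ℓ μ vtx em` says that the metric measure space `X` (with its ambient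
metric `dist` and measure `μ`) is the cable system of the graph `G` with length function `ℓ`:
each edge `{u,v}` of `G` corresponds to an isometrically embedded arc
`em u v : [0, ℓ u v] → X` (an arclength parametrisation), the arcs glue at the vertices and
cover `X`, the metric is the induced (maximal) length metric, and on each edge `μ` equals
`ℓ(e)` times arclength measure. -/
structure IsCableSystem (G : SimpleGraph V) (ℓ : V → V → ℝ) [MetricSpace X]
    [MeasurableSpace X] (μ : Measure X) (vtx : V → X) (em : V → V → ℝ → X) : Prop where
  len_pos : ∀ u v, G.Adj u v → 0 < ℓ u v
  len_symm : ∀ u v, ℓ u v = ℓ v u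
  edge_start : ∀ u v, G.Adj u v → em u v 0 = vtx u
  edge_flip : ∀ u v, G.Adj u v → ∀ s, em u v s = em v u (ℓ u v - s)
  edge_lip : ∀ u v, G.Adj u v → ∀ s ∈ Icc 0 (ℓ u v), ∀ t ∈ Icc 0 (ℓ u v),
    dist (em u v s) (em u v t) ≤ |s - t|
  edge_inj : ∀ u v, G.Adj u v → InjOn (em u v) (Icc 0 (ℓ u v))
  cover : ∀ x : X, ∃ u v s, G.Adj u v ∧ s ∈ Icc 0 (ℓ u v) ∧ em u v s = x
  interior_disjoint : ∀ u v u' v', G.Adj u v → G.Adj u' v' →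
    ∀ s ∈ Ioo 0 (ℓ u v), ∀ s' ∈ Ioo 0 (ℓ u' v'), em u v s = em u' v' s' →
      (u = u' ∧ v = v' ∧ s = s') ∨ (u = v' ∧ v = u' ∧ s = ℓ u v - s')
  isBorel : BorelSpace X
  dist_maximal : ∀ d' : X → X → ℝ, (∀ x, d' x x = 0) → (∀ x y, d' x y = d' y x) →
    (∀ x y z, d' x z ≤ d' x y + d' y z) →
    (∀ u v, G.Adj u v → ∀ s ∈ Icc 0 (ℓ u v), ∀ t ∈ Icc 0 (ℓ u v),
      d' (em u v s) (em u v t) ≤ |s - t|) →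
    ∀ x y, d' x y ≤ dist x y
  measure_edge : ∀ u v, G.Adj u v → ∀ A : Set ℝ, MeasurableSet A → A ⊆ Icc 0 (ℓ u v) →
    μ (em u v '' A) = ENNReal.ofReal (ℓ u v) * volume A

/-- `HasGradMod G ℓ em f g` : `f` is absolutely continuous (continuous on `X` and absolutely
continuous along each edge) and `g` is (a version of) the length of its gradient `|∇_ℓ f|`,
i.e. `g ≥ 0` and on each edge `f` is the integral of a signed derivative `h` with `|h| = g`
along the edge a.e. -/
def HasGradMod [TopologicalSpace X] (G : SimpleGraph V) (ℓ : V → V → ℝ)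
    (em : V → V → ℝ → X) (f g : X → ℝ) : Prop :=
  Continuous f ∧ (∀ x, 0 ≤ g x) ∧
    ∀ u v, G.Adj u v → ∃ h : ℝ → ℝ, IntegrableOn h (Icc 0 (ℓ u v)) ∧
      (∀ᵐ t ∂(volume.restrict (Icc 0 (ℓ u v))), |h t| = g (em u v t)) ∧
      ∀ t ∈ Icc 0 (ℓ u v), f (em u v t) = f (em u v 0) + ∫ s in Ioc 0 t, h s

/-- `HasEdgeDeriv G ℓ em f h` : `f` is absolutely continuous with (signed) edgewise derivative
`h u v : [0, ℓ u v] → ℝ` with respect to arclength along the (oriented) edge `(u,v)`. -/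
def HasEdgeDeriv [TopologicalSpace X] (G : SimpleGraph V) (ℓ : V → V → ℝ)
    (em : V → V → ℝ → X) (f : X → ℝ) (h : V → V → ℝ → ℝ) : Prop :=
  Continuous f ∧ ∀ u v, G.Adj u v → IntegrableOn (h u v) (Icc 0 (ℓ u v)) ∧
    ∀ t ∈ Icc 0 (ℓ u v), f (em u v t) = f (em u v 0) + ∫ s in Ioc 0 t, h u v s

/-- The Dirichlet energy `D(f,f) = ∫_X |∇_ℓ f|² dμ_ℓ` of an absolutely continuous function
(equal to `⊤` if `f` is not absolutely continuous). -/
def dirEnergy [TopologicalSpace X] [MeasurableSpace X] (G : SimpleGraph V)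
    (ℓ : V → V → ℝ) (em : V → V → ℝ → X) (μ : Measure X) (f : X → ℝ) : ℝ≥0∞ :=
  ⨅ (g : X → ℝ) (_ : HasGradMod G ℓ em f g), ∫⁻ x, ENNReal.ofReal (g x ^ 2) ∂μ

/-- `f` belongs to `F_D`: the closure, in the norm `(D(·,·) + ‖·‖²_{L²(μ)})^{1/2}`, of the
set of absolutely continuous, finite-energy functions with compact support contained in
`Dom`. -/
def MemFD [TopologicalSpace X] [MeasurableSpace X] (G : SimpleGraph V) (ℓ : V → V → ℝ)
    (em : V → V → ℝ → X) (μ : Measure X) (Dom : Set X) (f : X → ℝ) : Prop :=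
  ∃ F : ℕ → X → ℝ,
    (∀ n, (∃ g, HasGradMod G ℓ em (F n) g) ∧ HasCompactSupport (F n) ∧
      tsupport (F n) ⊆ Dom ∧ dirEnergy G ℓ em μ (F n) < ⊤) ∧
    Tendsto (fun n => dirEnergy G ℓ em μ (fun x => F n x - f x)
      + ∫⁻ x, ENNReal.ofReal ((F n x - f x) ^ 2) ∂μ) atTop (nhds 0)

/-- The capacity `Cap_D(A)`: the infimum of the Dirichlet energy over all `f ∈ F_D` with
`f ≥ 1` on a neighbourhood of `A`. -/
def capacity [TopologicalSpace X] [MeasurableSpace X] (G : SimpleGraph V) (ℓ : V → V → ℝ)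
    (em : V → V → ℝ → X) (μ : Measure X) (Dom A : Set X) : ℝ≥0∞ :=
  ⨅ (f : X → ℝ) (_ : MemFD G ℓ em μ Dom f ∧
      ∃ U : Set X, IsOpen U ∧ A ⊆ U ∧ ∀ x ∈ U, 1 ≤ f x),
    dirEnergy G ℓ em μ f

/-- The capacity upper bound `(cap_≤)`: there exist `C, M ≥ 1` with
`Cap_{B(x,Mr)}(B(x,r)) ≤ C` for all `x ∈ X` and `r ≥ 1`. -/
def CapLE [MetricSpace X] [MeasurableSpace X] (G : SimpleGraph V) (ℓ : V → V → ℝ)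
    (em : V → V → ℝ → X) (μ : Measure X) : Prop :=
  ∃ C M : ℝ, 1 ≤ C ∧ 1 ≤ M ∧ ∀ (x : X) (r : ℝ), 1 ≤ r →
    capacity G ℓ em μ (ball x (M * r)) (ball x r) ≤ ENNReal.ofReal C

/-- A curve in `X`: the data of an interval `[a,b]` and a map `ℝ → X` (to be continuous
on `[a,b]`). -/
abbrev CurveData (X : Type*) : Type _ := ℝ × ℝ × (ℝ → X)

/-- `g : [0,L] → X` is a `1`-Lipschitz parametrisation of the curve `c` on `[c.1, c.2.1]`
(such a parametrisation exists iff `c` is rectifiable, and the infimum of `∫_0^L ρ∘g` over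
all such parametrisations is the arclength line integral `∫_c ρ ds`). -/
def IsLipParamOf [PseudoMetricSpace X] (g : ℝ → X) (L : ℝ) (c : CurveData X) : Prop :=
  0 ≤ L ∧ LipschitzOnWith 1 g (Icc 0 L) ∧
    ∃ φ : ℝ → ℝ, MonotoneOn φ (Icc c.1 c.2.1) ∧ φ '' Icc c.1 c.2.1 = Icc 0 L ∧
      ∀ t ∈ Icc c.1 c.2.1, g (φ t) = c.2.2 t

/-- `ρ` is admissible for the curve family `Γ`: every (locally) rectifiable curve of `Γ` has
arclength line integral `∫_γ ρ ds ≥ 1`; equivalently `∫_{[0,L]} ρ ∘ g ≥ 1` for every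
`1`-Lipschitz parametrisation `g : [0,L] → X` of a curve of `Γ`. -/
def ModAdmissible [PseudoMetricSpace X] (Γ : Set (CurveData X)) (ρ : X → ℝ≥0∞) : Prop :=
  ∀ c ∈ Γ, ∀ (g : ℝ → X) (L : ℝ), IsLipParamOf g L c → 1 ≤ ∫⁻ t in Icc 0 L, ρ (g t)

/-- The `2`-modulus of a curve family. -/
def modulus [PseudoMetricSpace X] [MeasurableSpace X] (μ : Measure X)
    (Γ : Set (CurveData X)) : ℝ≥0∞ :=
  ⨅ (ρ : X → ℝ≥0∞) (_ : Measurable ρ ∧ ModAdmissible Γ ρ), ∫⁻ x, ρ x ^ 2 ∂μ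

/-- The family of curves joining `E` and `F`. -/
def JoiningCurves [TopologicalSpace X] (E F : Set X) : Set (CurveData X) :=
  {c | c.1 ≤ c.2.1 ∧ ContinuousOn c.2.2 (Icc c.1 c.2.1) ∧ c.2.2 c.1 ∈ E ∧ c.2.2 c.2.1 ∈ F}

/-- Distance between two sets. -/
def setDist [PseudoMetricSpace X] (E F : Set X) : ℝ :=
  sInf ((fun q : X × X => dist q.1 q.2) '' E ×ˢ F)

/-- The Poincaré inequality `PI(Ψ)` for the cable system. -/
def PoincareIneq [MetricSpace X] [MeasurableSpace X] (G : SimpleGraph V) (ℓ : V → V → ℝ)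
    (em : V → V → ℝ → X) (μ : Measure X) (Ψ : ℝ → ℝ) : Prop :=
  ∃ C M : ℝ, 1 ≤ C ∧ 1 ≤ M ∧
    ∀ f g : X → ℝ, HasGradMod G ℓ em f g → (∫⁻ x, ENNReal.ofReal (g x ^ 2) ∂μ) < ⊤ →
      ∀ (x : X) (r : ℝ), 0 < r → ENNReal.ofReal (2 * r) < EMetric.diam (univ : Set X) →
        ∫⁻ y in ball x r, ENNReal.ofReal ((f y - ⨍ z in ball x r, f z ∂μ) ^ 2) ∂μ ≤
          ENNReal.ofReal (C * Ψ r) * ∫⁻ y in ball x (M * r), ENNReal.ofReal (g y ^ 2) ∂μ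

/-- Annular quasi-convexity at large scales. -/
def AnnularQCLargeScales (X : Type*) [PseudoMetricSpace X] : Prop :=
  ∃ R C : ℝ, 0 < R ∧ 0 < C ∧ ∀ (x : X) (r : ℝ), R ≤ r →
    ∀ y ∈ ball x (2 * r) \ ball x r, ∀ z ∈ ball x (2 * r) \ ball x r,
      ∃ (a b : ℝ) (γ : ℝ → X), a ≤ b ∧ ContinuousOn γ (Icc a b) ∧ γ a = y ∧ γ b = z ∧
        ∀ t ∈ Icc a b, γ t ∈ ball x (C * r) \ ball x (r / C)


open Topology

/-- A connected, locally finite graph has countably many vertices. -/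
theorem countable_of_connected_of_locallyFinite {W : Type*} {G : SimpleGraph W}
    (hconn : G.Connected) (hlf : ∀ v : W, (G.neighborSet v).Finite) : Countable W := by
  obtain ⟨v₀⟩ := hconn.nonempty
  let S : ℕ → Set W := fun n => Nat.rec {v₀} (fun _ T => ⋃ u ∈ T, G.neighborSet u) n
  have hS : ∀ n, (S n).Countable := by
    intro n
    induction n with
    | zero => exact countable_singleton v₀
    | succ n ih => exact ih.biUnion fun u _ => (hlf u).countable
  have hwalk : ∀ {a b : W} (p : G.Walk a b), a ∈ ⋃ n, S n → b ∈ ⋃ n, S n := by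
    intro a b p
    induction p with
    | nil => exact id
    | cons hadj _ ih =>
      intro ha
      obtain ⟨n, hn⟩ := mem_iUnion.1 ha
      exact ih (mem_iUnion.2 ⟨n + 1, mem_biUnion hn hadj⟩)
  have huniv : (⋃ n, S n) = univ := eq_univ_of_forall fun v => by
    obtain ⟨p⟩ := hconn.preconnected v₀ v
    exact hwalk p (mem_iUnion.2 ⟨0, rfl⟩)
  exact countable_univ_iff.1 (huniv ▸ countable_iUnion hS)

theorem AbsolutelyContinuousOnInterval.fun_min {φ ψ : ℝ → ℝ} {a b : ℝ}
    (hφ : AbsolutelyContinuousOnInterval φ a b) (hψ : AbsolutelyContinuousOnInterval ψ a b) :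
    AbsolutelyContinuousOnInterval (fun t => min (φ t) (ψ t)) a b := by
  apply squeeze_zero (fun t ↦ ?_) (fun t ↦ ?_) (by simpa using Tendsto.add hφ hψ)
  · exact Finset.sum_nonneg (fun i hi ↦ by positivity)
  · rw [← Finset.sum_add_distrib]
    gcongr
    simp only [Real.dist_eq]
    refine (abs_min_sub_min_le_max _ _ _ _).trans (max_le ?_ ?_)
    · exact le_add_of_nonneg_right (abs_nonneg _)
    · exact le_add_of_nonneg_left (abs_nonneg _)

theorem AbsolutelyContinuousOnInterval.congr_uIcc {φ ψ : ℝ → ℝ} {a b : ℝ}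
    (hφ : AbsolutelyContinuousOnInterval φ a b) (h : EqOn φ ψ (uIcc a b)) :
    AbsolutelyContinuousOnInterval ψ a b := by
  rw [absolutelyContinuousOnInterval_iff] at hφ ⊢
  intro ε hε
  obtain ⟨δ, hδ, H⟩ := hφ ε hε
  refine ⟨δ, hδ, fun E hE hlen => ?_⟩
  refine lt_of_eq_of_lt (Finset.sum_congr rfl fun i hi => ?_) (H E hE hlen)
  rw [h (hE.1 i hi).1, h (hE.1 i hi).2]

/-- If `φ` and `φ ∧ ψ` are differentiable at `t` and `φ t ≤ ψ t` (equality allowed), then their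
derivatives at `t` agree. -/
theorem deriv_min_eq_left {φ ψ : ℝ → ℝ} {t : ℝ} (hφ : DifferentiableAt ℝ φ t)
    (hm : DifferentiableAt ℝ (fun s => min (φ s) (ψ s)) t) (h : φ t ≤ ψ t) : deriv (fun s => min (φ s) (ψ s)) t = deriv φ t := by
  have hmin : IsLocalMin (fun s => φ s - min (φ s) (ψ s)) t := by
    refine Eventually.of_forall fun s => ?_
    simp [h]
  have h0 := hmin.deriv_eq_zero
  rw [deriv_fun_sub hφ hm] at h0
  linarith

theorem deriv_min_eq_right {φ ψ : ℝ → ℝ} {t : ℝ}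
    (hψ : DifferentiableAt ℝ ψ t) (hm : DifferentiableAt ℝ (fun s => min (φ s) (ψ s)) t)
    (h : ψ t ≤ φ t) : deriv (fun s => min (φ s) (ψ s)) t = deriv ψ t := by
  simp only [min_comm (φ _)] at hm ⊢
  exact deriv_min_eq_left hψ hm h

/-- `f` is absolutely continuous on the cable system. -/
def EdgeAC [TopologicalSpace X] (G : SimpleGraph V) (ℓ : V → V → ℝ)
    (em : V → V → ℝ → X) (f : X → ℝ) : Prop :=
  Continuous f ∧ ∀ u v, G.Adj u v →
    AbsolutelyContinuousOnInterval (fun t => f (em u v t)) 0 (ℓ u v)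

open Classical in
/-- The absolute value of the edgewise derivative of `f` (and `0` at the vertices). -/
def gradMod (G : SimpleGraph V) (ℓ : V → V → ℝ) (em : V → V → ℝ → X) (f : X → ℝ) (x : X) : ℝ :=
  if h : ∃ p : V × V × ℝ, G.Adj p.1 p.2.1 ∧ p.2.2 ∈ Ioo 0 (ℓ p.1 p.2.1) ∧
      em p.1 p.2.1 p.2.2 = x then
    |deriv (fun t => f (em h.choose.1 h.choose.2.1 t)) h.choose.2.2|
  else 0

theorem gradMod_nonneg {G : SimpleGraph V} {ℓ : V → V → ℝ} {em : V → V → ℝ → X} {f : X → ℝ}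
    (x : X) : 0 ≤ gradMod G ℓ em f x := by
  unfold gradMod
  split_ifs
  · exact abs_nonneg _
  · exact le_rfl

section EdgeAC

variable [TopologicalSpace X] {G : SimpleGraph V} {ℓ : V → V → ℝ} {em : V → V → ℝ → X}
  {f g : X → ℝ}

theorem EdgeAC.sub (hf : EdgeAC G ℓ em f) (hg : EdgeAC G ℓ em g) :
    EdgeAC G ℓ em (fun x => f x - g x) :=
  ⟨hf.1.sub hg.1, fun u v huv => (hf.2 u v huv).fun_sub (hg.2 u v huv)⟩

theorem EdgeAC.min (hf : EdgeAC G ℓ em f) (hg : EdgeAC G ℓ em g) :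
    EdgeAC G ℓ em (fun x => min (f x) (g x)) :=
  ⟨hf.1.min hg.1, fun u v huv => (hf.2 u v huv).fun_min (hg.2 u v huv)⟩

end EdgeAC

namespace IsCableSystem

variable [MetricSpace X] [MeasurableSpace X] {G : SimpleGraph V} {ℓ : V → V → ℝ}
  {μ : Measure X} {vtx : V → X} {em : V → V → ℝ → X} {f g gm : X → ℝ}

theorem gradMod_edge (hcs : IsCableSystem G ℓ μ vtx em) (f : X → ℝ) {u v : V} (huv : G.Adj u v)
    {t : ℝ} (ht : t ∈ Ioo 0 (ℓ u v)) :
    gradMod G ℓ em f (em u v t) = |deriv (fun s => f (em u v s)) t| := by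
  have h : ∃ p : V × V × ℝ, G.Adj p.1 p.2.1 ∧ p.2.2 ∈ Ioo 0 (ℓ p.1 p.2.1) ∧
      em p.1 p.2.1 p.2.2 = em u v t := ⟨(u, v, t), huv, ht, rfl⟩
  rw [gradMod, dif_pos h]
  obtain ⟨h1, h2, h3⟩ := h.choose_spec
  generalize h.choose = p at *
  obtain ⟨u', v', t'⟩ := p
  dsimp only at *
  rcases hcs.interior_disjoint u' v' u v h1 huv t' h2 t ht h3 with ⟨rfl, rfl, rfl⟩ | ⟨rfl, rfl, rfl⟩
  · rfl
  · have : (fun s => f (em u' v' s)) = fun s => (fun r => f (em v' u' r)) (ℓ u' v' - s) := by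
      funext s
      rw [hcs.edge_flip u' v' h1 s]
    rw [this, deriv_comp_const_sub (f := fun r => f (em v' u' r))]
    simp

theorem ae_mem_Ioo (u v : V) :
    ∀ᵐ t ∂(volume.restrict (Icc 0 (ℓ u v))), t ∈ Ioo 0 (ℓ u v) := by
  rw [← restrict_Ioo_eq_restrict_Icc]
  exact ae_restrict_mem measurableSet_Ioo

theorem edgeAC_of_hasGradMod (hcs : IsCableSystem G ℓ μ vtx em) (h : HasGradMod G ℓ em f gm) :
    EdgeAC G ℓ em f := by
  refine ⟨h.1, fun u v huv => ?_⟩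
  obtain ⟨d, hd, -, hprim⟩ := h.2.2 u v huv
  have hl := (hcs.len_pos u v huv).le
  have hI : IntervalIntegrable d volume 0 (ℓ u v) :=
    (intervalIntegrable_iff_integrableOn_Icc_of_le hl).2 hd
  have hc : AbsolutelyContinuousOnInterval (fun _ => f (em u v 0)) 0 (ℓ u v) :=
    ((LipschitzWith.const (f (em u v 0))).lipschitzOnWith).absolutelyContinuousOnInterval
  refine (hc.fun_add
    (hI.absolutelyContinuousOnInterval_intervalIntegral left_mem_uIcc)).congr_uIcc fun t ht => ?_
  rw [uIcc_of_le hl] at ht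
  simp only
  rw [hprim t ht, intervalIntegral.integral_of_le ht.1]

theorem hasGradMod_edge (hcs : IsCableSystem G ℓ μ vtx em) (h : HasGradMod G ℓ em f gm)
    {u v : V} (huv : G.Adj u v) :
    ∀ᵐ t ∂(volume.restrict (Icc 0 (ℓ u v))), gm (em u v t) = gradMod G ℓ em f (em u v t) := by
  obtain ⟨d, hd, habs, hprim⟩ := h.2.2 u v huv
  have hl := (hcs.len_pos u v huv).le
  have hI : IntervalIntegrable d volume 0 (ℓ u v) :=
    (intervalIntegrable_iff_integrableOn_Icc_of_le hl).2 hd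
  filter_upwards [habs, ae_mem_Ioo u v, ae_restrict_of_ae hI.ae_hasDerivAt_integral]
    with t h1 h2 h3
  rw [hcs.gradMod_edge f huv h2, ← h1]
  rw [uIcc_of_le hl] at h3
  have h4 := (h3 (Ioo_subset_Icc_self h2) 0 (left_mem_Icc.2 hl)).const_add (f (em u v 0))
  have h5 : (fun s => f (em u v s)) =ᶠ[𝓝 t] fun s => f (em u v 0) + ∫ r in (0 : ℝ)..s, d r := by
    filter_upwards [Ioo_mem_nhds h2.1 h2.2] with s hs
    rw [hprim s (Ioo_subset_Icc_self hs), intervalIntegral.integral_of_le hs.1.le]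
  rw [h5.deriv_eq, h4.deriv]

theorem hasGradMod_gradMod (hcs : IsCableSystem G ℓ μ vtx em) (hf : EdgeAC G ℓ em f) :
    HasGradMod G ℓ em f (gradMod G ℓ em f) := by
  refine ⟨hf.1, gradMod_nonneg, fun u v huv => ?_⟩
  have hl := (hcs.len_pos u v huv).le
  refine ⟨deriv (fun t => f (em u v t)), ?_, ?_, fun t ht => ?_⟩
  · exact (intervalIntegrable_iff_integrableOn_Icc_of_le hl).1 (hf.2 u v huv).intervalIntegrable_deriv
  · filter_upwards [ae_mem_Ioo u v] with t ht
    rw [hcs.gradMod_edge f huv ht]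
  · have := ((hf.2 u v huv).mono (c := 0) (d := t) (by
      rw [uIcc_of_le hl, uIcc_of_le ht.1]; exact Icc_subset_Icc_right ht.2)).integral_deriv_eq_sub
    rw [← intervalIntegral.integral_of_le ht.1, this]
    ring

/-- On each edge, `μ` is a multiple of the pushforward of Lebesgue measure. -/
theorem measurableEmbedding_edge (hcs : IsCableSystem G ℓ μ vtx em) {u v : V} (huv : G.Adj u v) :
    MeasurableEmbedding ((Icc 0 (ℓ u v)).domRestrict (em u v)) := by
  have := hcs.isBorel
  have hcont : ContinuousOn (em u v) (Icc 0 (ℓ u v)) := by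
    refine LipschitzOnWith.continuousOn (K := 1) (LipschitzOnWith.of_dist_le_mul fun s hs t ht => ?_)
    simpa [Real.dist_eq] using hcs.edge_lip u v huv s hs t ht
  exact (hcont.domRestrict.isClosedEmbedding
    (injOn_iff_injective.1 (hcs.edge_inj u v huv))).measurableEmbedding

theorem restrict_edge_eq_map (hcs : IsCableSystem G ℓ μ vtx em) {u v : V} (huv : G.Adj u v) :
    μ.restrict (em u v '' Icc 0 (ℓ u v)) = Measure.map ((Icc 0 (ℓ u v)).domRestrict (em u v))
      (ENNReal.ofReal (ℓ u v) • Measure.comap Subtype.val volume) := by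
  have he := hcs.measurableEmbedding_edge huv
  rw [← range_domRestrict, ← he.map_comap]
  congr 1
  ext A hA
  rw [he.comap_apply, Measure.smul_apply, smul_eq_mul,
    (MeasurableEmbedding.subtype_coe measurableSet_Icc).comap_apply, ← hcs.measure_edge u v huv]
  · rw [image_image]; rfl
  · exact measurableSet_Icc.subtype_image hA
  · exact Subtype.coe_image_subset _ _

theorem iUnion_edges (hcs : IsCableSystem G ℓ μ vtx em) :
    (⋃ p : {p : V × V // G.Adj p.1 p.2}, em p.1.1 p.1.2 '' Icc 0 (ℓ p.1.1 p.1.2)) = univ := by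
  refine eq_univ_of_forall fun x => ?_
  obtain ⟨u, v, s, huv, hs, rfl⟩ := hcs.cover x
  exact mem_iUnion.2 ⟨⟨(u, v), huv⟩, mem_image_of_mem _ hs⟩

theorem ae_of_forall_edge [Countable V] (hcs : IsCableSystem G ℓ μ vtx em) {P : X → Prop}
    (h : ∀ u v, G.Adj u v → ∀ᵐ t ∂(volume.restrict (Icc 0 (ℓ u v))), P (em u v t)) :
    ∀ᵐ x ∂μ, P x := by
  rw [← Measure.restrict_univ (μ := μ), ← hcs.iUnion_edges, ae_restrict_iUnion_iff]
  rintro ⟨⟨u, v⟩, huv⟩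
  dsimp only at huv ⊢
  rw [hcs.restrict_edge_eq_map huv, (hcs.measurableEmbedding_edge huv).ae_map_iff]
  refine Measure.ae_smul_measure ?_ _
  exact (ae_restrict_iff_subtype measurableSet_Icc).1 (h u v huv)

theorem aemeasurable_gradMod [Countable V] (hcs : IsCableSystem G ℓ μ vtx em)
    (f : X → ℝ) : AEMeasurable (gradMod G ℓ em f) μ := by
  rw [← Measure.restrict_univ (μ := μ), ← hcs.iUnion_edges, aemeasurable_iUnion_iff]
  rintro ⟨⟨u, v⟩, huv⟩
  dsimp only at huv ⊢
  rw [hcs.restrict_edge_eq_map huv, (hcs.measurableEmbedding_edge huv).aemeasurable_map_iff]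
  refine AEMeasurable.smul_measure ?_ _
  have h1 : AEMeasurable (fun t => gradMod G ℓ em f (em u v t))
      (volume.restrict (Icc 0 (ℓ u v))) := by
    refine (measurable_deriv (fun t => f (em u v t))).abs.aemeasurable.congr ?_
    filter_upwards [ae_mem_Ioo u v] with t ht
    rw [hcs.gradMod_edge f huv ht]
  rw [← map_comap_subtype_coe measurableSet_Icc,
    (MeasurableEmbedding.subtype_coe measurableSet_Icc).aemeasurable_map_iff] at h1
  exact h1

/-- The Dirichlet energy is computed by the canonical gradient. -/
theorem dirEnergy_eq [Countable V] (hcs : IsCableSystem G ℓ μ vtx em) (hf : EdgeAC G ℓ em f) :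
    dirEnergy G ℓ em μ f = ∫⁻ x, ENNReal.ofReal (gradMod G ℓ em f x ^ 2) ∂μ := by
  refine le_antisymm (iInf₂_le _ (hcs.hasGradMod_gradMod hf)) (le_iInf₂ fun gm hgm => ?_)
  refine (lintegral_congr_ae ?_).le
  filter_upwards [hcs.ae_of_forall_edge (P := fun x => gm x = gradMod G ℓ em f x)
    fun u v huv => hcs.hasGradMod_edge hgm huv] with x hx
  rw [hx]

theorem edgeAC_of_dirEnergy_lt_top (hcs : IsCableSystem G ℓ μ vtx em)
    (h : dirEnergy G ℓ em μ f < ⊤) : EdgeAC G ℓ em f := by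
  obtain ⟨gm, hgm⟩ := iInf_lt_iff.1 h
  obtain ⟨hgm, -⟩ := iInf_lt_iff.1 hgm
  exact hcs.edgeAC_of_hasGradMod hgm

/-- At almost every point of an edge, an absolutely continuous function is differentiable along
the edge and its canonical gradient is the absolute value of the derivative. -/
theorem ae_edge (hcs : IsCableSystem G ℓ μ vtx em) (hf : EdgeAC G ℓ em f) {u v : V}
    (huv : G.Adj u v) : ∀ᵐ t ∂(volume.restrict (Icc 0 (ℓ u v))),
      DifferentiableAt ℝ (fun s => f (em u v s)) t ∧
      gradMod G ℓ em f (em u v t) = |deriv (fun s => f (em u v s)) t| := by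
  filter_upwards [ae_mem_Ioo u v, ae_restrict_of_ae (hf.2 u v huv).ae_differentiableAt]
    with t h1 h2
  rw [uIcc_of_le (hcs.len_pos u v huv).le] at h2
  exact ⟨h2 (Ioo_subset_Icc_self h1), hcs.gradMod_edge f huv h1⟩

theorem ae_gradMod_sub_le [Countable V] (hcs : IsCableSystem G ℓ μ vtx em)
    (hf : EdgeAC G ℓ em f) (hg : EdgeAC G ℓ em g) :
    ∀ᵐ x ∂μ, gradMod G ℓ em (fun y => f y - g y) x ≤
      gradMod G ℓ em f x + gradMod G ℓ em g x := by
  refine hcs.ae_of_forall_edge fun u v huv => ?_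
  filter_upwards [hcs.ae_edge hf huv, hcs.ae_edge hg huv, hcs.ae_edge (hf.sub hg) huv]
    with t h1 h2 h3
  rw [h1.2, h2.2, h3.2, deriv_fun_sub h1.1 h2.1]
  exact abs_sub _ _

theorem ae_gradMod_min_le [Countable V] (hcs : IsCableSystem G ℓ μ vtx em)
    (hf : EdgeAC G ℓ em f) (hg : EdgeAC G ℓ em g) :
    ∀ᵐ x ∂μ, gradMod G ℓ em (fun y => min (f y) (g y)) x ≤
      gradMod G ℓ em f x + gradMod G ℓ em g x := by
  refine hcs.ae_of_forall_edge fun u v huv => ?_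
  filter_upwards [hcs.ae_edge hf huv, hcs.ae_edge hg huv, hcs.ae_edge (hf.min hg) huv]
    with t h1 h2 h3
  rw [h1.2, h2.2, h3.2]
  rcases le_total (f (em u v t)) (g (em u v t)) with h | h
  · rw [deriv_min_eq_left h1.1 h3.1 h]
    exact le_add_of_nonneg_right (abs_nonneg _)
  · rw [deriv_min_eq_right h2.1 h3.1 h]
    exact le_add_of_nonneg_left (abs_nonneg _)

theorem ae_gradMod_sub_eq_zero [Countable V] (hcs : IsCableSystem G ℓ μ vtx em)
    (hf : EdgeAC G ℓ em f) (hg : EdgeAC G ℓ em g) :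
    ∀ᵐ x ∂μ, f x = g x → gradMod G ℓ em (fun y => f y - g y) x = 0 := by
  refine hcs.ae_of_forall_edge fun u v huv => ?_
  filter_upwards [hcs.ae_edge hf huv, hcs.ae_edge hg huv, hcs.ae_edge (hf.sub hg) huv,
    hcs.ae_edge (hf.min hg) huv] with t h1 h2 h3 h4 h
  rw [h3.2, deriv_fun_sub h1.1 h2.1, ← deriv_min_eq_left h1.1 h4.1 h.le,
    ← deriv_min_eq_right h2.1 h4.1 h.ge, sub_self, abs_zero]

open Classical in
/-- Gradients of differences of minima: off the set where `F` and `f` lie on different sides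
of `g`, the gradient of `F ∧ g - f ∧ g` is controlled by that of `F - f`. -/
theorem ae_gradMod_min_sub_min_le [Countable V] (hcs : IsCableSystem G ℓ μ vtx em)
    {F : X → ℝ} (hF : EdgeAC G ℓ em F) (hf : EdgeAC G ℓ em f) (hg : EdgeAC G ℓ em g) :
    ∀ᵐ x ∂μ, gradMod G ℓ em (fun y => min (F y) (g y) - min (f y) (g y)) x ≤
      gradMod G ℓ em (fun y => F y - f y) x +
        (if F x < g x ↔ f x < g x then 0 else gradMod G ℓ em (fun y => f y - g y) x) := by
  refine hcs.ae_of_forall_edge fun u v huv => ?_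
  filter_upwards [hcs.ae_edge hF huv, hcs.ae_edge hf huv, hcs.ae_edge hg huv,
    hcs.ae_edge (hF.min hg) huv, hcs.ae_edge (hf.min hg) huv, hcs.ae_edge (hF.sub hf) huv,
    hcs.ae_edge (hf.sub hg) huv, hcs.ae_edge ((hF.min hg).sub (hf.min hg)) huv]
    with t h1 h2 h3 h4 h5 h6 h7 h8
  rw [h6.2, h7.2, h8.2, deriv_fun_sub h1.1 h2.1, deriv_fun_sub h2.1 h3.1,
    deriv_fun_sub h4.1 h5.1]
  rcases lt_or_ge (F (em u v t)) (g (em u v t)) with hF' | hF' <;>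
    rcases lt_or_ge (f (em u v t)) (g (em u v t)) with hf' | hf'
  · rw [if_pos (by simp [hF', hf']), deriv_min_eq_left h1.1 h4.1 hF'.le,
      deriv_min_eq_left h2.1 h5.1 hf'.le, add_zero]
  · rw [if_neg (by simp [hF', hf']), deriv_min_eq_left h1.1 h4.1 hF'.le,
      deriv_min_eq_right h3.1 h5.1 hf']
    exact abs_sub_le _ _ _
  · rw [if_neg (by simp [hF', hf']), deriv_min_eq_right h3.1 h4.1 hF',
      deriv_min_eq_left h2.1 h5.1 hf'.le, abs_sub_comm]
    exact le_add_of_nonneg_left (abs_nonneg _)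
  · rw [if_pos (by simp [hF'.not_gt, hf'.not_gt]), deriv_min_eq_right h3.1 h4.1 hF',
      deriv_min_eq_right h3.1 h5.1 hf', sub_self, abs_zero, add_zero]
    exact abs_nonneg _

end IsCableSystem

theorem lintegral_ofReal_sq_le_of_ae_le_add {Ω : Type*} [MeasurableSpace Ω] {ν : Measure Ω}
    {a b c : Ω → ℝ} (hb : AEMeasurable b ν) (ha : ∀ x, 0 ≤ a x)
    (h : ∀ᵐ x ∂ν, a x ≤ b x + c x) :
    ∫⁻ x, ENNReal.ofReal (a x ^ 2) ∂ν ≤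
      2 * ∫⁻ x, ENNReal.ofReal (b x ^ 2) ∂ν + 2 * ∫⁻ x, ENNReal.ofReal (c x ^ 2) ∂ν := by
  rw [← lintegral_const_mul' _ _ ENNReal.ofNat_ne_top,
    ← lintegral_const_mul' _ _ ENNReal.ofNat_ne_top,
    ← lintegral_add_left' ((hb.pow_const 2).ennreal_ofReal.const_mul 2)]
  refine lintegral_mono_ae ?_
  filter_upwards [h] with x hx
  have h2 : (2 : ℝ≥0∞) = ENNReal.ofReal 2 := by simp
  rw [h2, ← ENNReal.ofReal_mul zero_le_two, ← ENNReal.ofReal_mul zero_le_two,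
    ← ENNReal.ofReal_add (by positivity) (by positivity)]
  refine ENNReal.ofReal_le_ofReal ?_
  nlinarith [ha x, sq_nonneg (b x - c x), pow_le_pow_left₀ (ha x) hx 2]

/-- Convergence in `L²` implies almost everywhere convergence of a subsequence. -/
theorem exists_seq_tendsto_ae_of_lintegral_sq {Ω : Type*} [MeasurableSpace Ω] {ν : Measure Ω}
    {F : ℕ → Ω → ℝ} {f : Ω → ℝ} (hm : ∀ n, AEStronglyMeasurable (fun x => F n x - f x) ν)
    (h : Tendsto (fun n => ∫⁻ x, ENNReal.ofReal ((F n x - f x) ^ 2) ∂ν) atTop (𝓝 0)) :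
    ∃ ns : ℕ → ℕ, StrictMono ns ∧
      ∀ᵐ x ∂ν, Tendsto (fun k => F (ns k) x) atTop (𝓝 (f x)) := by
  have h1 : TendstoInMeasure ν (fun n x => (F n x - f x) ^ 2) atTop (fun _ => 0) := by
    refine tendstoInMeasure_of_tendsto_eLpNorm (p := 1) one_ne_zero (fun n => (hm n).pow 2)
      aestronglyMeasurable_const (h.congr fun n => ?_)
    rw [eLpNorm_one_eq_lintegral_enorm]
    refine lintegral_congr fun x => ?_
    simp only [Pi.sub_apply, sub_zero]
    rw [Real.enorm_of_nonneg (sq_nonneg _)]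
  obtain ⟨ns, hns, hae⟩ := h1.exists_seq_tendsto_ae
  refine ⟨ns, hns, hae.mono fun x hx => ?_⟩
  have h2 := (Real.continuous_sqrt.tendsto 0).comp hx
  simp only [Function.comp_def, Real.sqrt_sq_eq_abs, Real.sqrt_zero] at h2
  exact tendsto_sub_nhds_zero_iff.1 ((tendsto_zero_iff_abs_tendsto_zero _).2 h2)

open Classical in
theorem IsCableSystem.tendsto_lintegral_sq_gradMod_of_side [MetricSpace X] [MeasurableSpace X]
    [Countable V] {G : SimpleGraph V} {ℓ : V → V → ℝ}
    {μ : Measure X} {vtx : V → X} {em : V → V → ℝ → X} {f g : X → ℝ} {F : ℕ → X → ℝ}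
    (hcs : IsCableSystem G ℓ μ vtx em) (hF : ∀ n, Continuous (F n))
    (hf : EdgeAC G ℓ em f) (hg : EdgeAC G ℓ em g)
    (hfin : ∫⁻ x, ENNReal.ofReal (gradMod G ℓ em (fun y => f y - g y) x ^ 2) ∂μ ≠ ⊤)
    (hlim : ∀ᵐ x ∂μ, Tendsto (fun n => F n x) atTop (𝓝 (f x))) :
    Tendsto (fun n => ∫⁻ x, ENNReal.ofReal ((if F n x < g x ↔ f x < g x then 0
      else gradMod G ℓ em (fun y => f y - g y) x) ^ 2) ∂μ) atTop (𝓝 0) := by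
  have := hcs.isBorel
  have hmeas := hcs.aemeasurable_gradMod (fun y => f y - g y)
  have key := tendsto_lintegral_of_dominated_convergence' (μ := μ) (f := fun _ => 0)
    (F := fun n x => ENNReal.ofReal ((if F n x < g x ↔ f x < g x then 0
      else gradMod G ℓ em (fun y => f y - g y) x) ^ 2))
    (fun x => ENNReal.ofReal (gradMod G ℓ em (fun y => f y - g y) x ^ 2)) ?_ ?_ hfin ?_
  · simpa using key
  · intro n
    refine AEMeasurable.ennreal_ofReal (AEMeasurable.pow_const ?_ 2)
    have hs : MeasurableSet {x | F n x < g x ↔ f x < g x} :=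
      (measurableSet_lt (hF n).measurable hg.1.measurable).iff
        (measurableSet_lt hf.1.measurable hg.1.measurable)
    refine (hmeas.indicator hs.compl).congr (Eventually.of_forall fun x => ?_)
    by_cases hx : F n x < g x ↔ f x < g x <;> simp [indicator, hx]
  · intro n
    refine Eventually.of_forall fun x => ENNReal.ofReal_le_ofReal ?_
    split_ifs
    · simpa using sq_nonneg _
    · exact le_rfl
  · filter_upwards [hlim, hcs.ae_gradMod_sub_eq_zero hf hg] with x hx h0
    refine tendsto_const_nhds.congr' ?_
    rcases lt_trichotomy (f x) (g x) with h | h | h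
    · filter_upwards [hx.eventually_lt_const h] with n hn
      simp [hn, h]
    · simp [h0 h]
    · filter_upwards [hx.eventually_const_lt h] with n hn
      simp [hn.not_gt, h.not_gt]

/-- **Lemma (stability of the Dirichlet domain under minima).**  Let `(X, d_ℓ, μ)` be the
cable system of a connected, locally finite, simple graph with a complete length function
`ℓ`, and let `F^ℓ` be the closure (in the norm `(D(·,·)+‖·‖²_{L²(μ)})^{1/2}`) of the set of
absolutely continuous, compactly supported, finite-energy functions.  Then for every
nonnegative `f ∈ F^ℓ` and every nonnegative absolutely continuous `g` with finite
Dirichlet energy, the pointwise minimum `f ∧ g` belongs to `F^ℓ`. -/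
theorem min_mem_dirichlet_domain
    {V X : Type*} [MetricSpace X] [MeasurableSpace X] [CompleteSpace X]
    (G : SimpleGraph V) (hconn : G.Connected) (hlf : ∀ v : V, (G.neighborSet v).Finite)
    (ℓ : V → V → ℝ) (μ : Measure X) (vtx : V → X) (em : V → V → ℝ → X)
    (hcs : IsCableSystem G ℓ μ vtx em)
    (f : X → ℝ) (hf : MemFD G ℓ em μ Set.univ f) (hf0 : ∀ x, 0 ≤ f x)
    (g : X → ℝ) (hg0 : ∀ x, 0 ≤ g x)
    (hgAC : ∃ gm : X → ℝ, HasGradMod G ℓ em g gm)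
    (hgE : dirEnergy G ℓ em μ g < ⊤) :
    MemFD G ℓ em μ Set.univ (fun x => min (f x) (g x)) := by
  classical
  have := hcs.isBorel
  have := countable_of_connected_of_locallyFinite hconn hlf
  obtain ⟨F, hF, hlim⟩ := hf
  obtain ⟨gm, hgm⟩ := hgAC
  have hg := hcs.edgeAC_of_hasGradMod hgm
  have hFAC : ∀ n, EdgeAC G ℓ em (F n) := fun n =>
    hcs.edgeAC_of_dirEnergy_lt_top (hF n).2.2.2
  obtain ⟨N, hN⟩ : ∃ N, dirEnergy G ℓ em μ (fun x => F N x - f x) < ⊤ :=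
    ((hlim.eventually_lt_const ENNReal.zero_lt_top).mono fun n hn =>
      lt_of_le_of_lt le_self_add hn).exists
  have hfAC : EdgeAC G ℓ em f := by
    have h := (hFAC N).sub (hcs.edgeAC_of_dirEnergy_lt_top hN)
    simpa only [sub_sub_cancel] using h
  have hmin := hfAC.min hg
  have hE : ∀ p, AEMeasurable (gradMod G ℓ em p) μ := hcs.aemeasurable_gradMod
  have hFfin : ∀ n, ∫⁻ x, ENNReal.ofReal (gradMod G ℓ em (F n) x ^ 2) ∂μ < ⊤ := fun n =>
    hcs.dirEnergy_eq (hFAC n) ▸ (hF n).2.2.2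
  have hgfin : ∫⁻ x, ENNReal.ofReal (gradMod G ℓ em g x ^ 2) ∂μ < ⊤ :=
    hcs.dirEnergy_eq hg ▸ hgE
  have hfin2 : ∀ a b : ℝ≥0∞, a < ⊤ → b < ⊤ → 2 * a + 2 * b < ⊤ := fun a b ha hb =>
    ENNReal.add_lt_top.2 ⟨ENNReal.mul_lt_top ENNReal.ofNat_lt_top ha,
      ENNReal.mul_lt_top ENNReal.ofNat_lt_top hb⟩
  have hffin : ∫⁻ x, ENNReal.ofReal (gradMod G ℓ em f x ^ 2) ∂μ < ⊤ := by
    have h := hcs.ae_gradMod_sub_le (hFAC N) ((hFAC N).sub hfAC)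
    simp only [sub_sub_cancel] at h
    exact (lintegral_ofReal_sq_le_of_ae_le_add (hE _) gradMod_nonneg h).trans_lt
      (hfin2 _ _ (hFfin N) (hcs.dirEnergy_eq ((hFAC N).sub hfAC) ▸ hN))
  have hfgfin := (lintegral_ofReal_sq_le_of_ae_le_add (hE _) gradMod_nonneg
    (hcs.ae_gradMod_sub_le hfAC hg)).trans_lt (hfin2 _ _ hffin hgfin)
  have hL2 : Tendsto (fun n => ∫⁻ x, ENNReal.ofReal ((F n x - f x) ^ 2) ∂μ) atTop (𝓝 0) :=
    tendsto_of_tendsto_of_tendsto_of_le_of_le tendsto_const_nhds hlim (fun _ => zero_le)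
      (fun _ => le_add_self)
  have hD : Tendsto (fun n => ∫⁻ x, ENNReal.ofReal
      (gradMod G ℓ em (fun y => F n y - f y) x ^ 2) ∂μ) atTop (𝓝 0) :=
    (tendsto_of_tendsto_of_tendsto_of_le_of_le tendsto_const_nhds hlim (fun _ => zero_le)
      (fun _ => le_self_add)).congr fun n => hcs.dirEnergy_eq ((hFAC n).sub hfAC)
  obtain ⟨ns, hns, hae⟩ := exists_seq_tendsto_ae_of_lintegral_sq
    (fun n => ((hFAC n).1.sub hfAC.1).measurable.aestronglyMeasurable) hL2
  have hside := hcs.tendsto_lintegral_sq_gradMod_of_side (fun k => (hFAC (ns k)).1) hfAC hg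
    hfgfin.ne hae
  refine ⟨fun k x => min (F (ns k) x) (g x), fun k => ⟨⟨_, hcs.hasGradMod_gradMod
    ((hFAC (ns k)).min hg)⟩, ?_, subset_univ _, ?_⟩, ?_⟩
  · refine (hF (ns k)).2.1.mono fun x hx h0 => hx ?_
    simp only [h0, min_eq_left (hg0 x)]
  · rw [hcs.dirEnergy_eq ((hFAC (ns k)).min hg)]
    exact (lintegral_ofReal_sq_le_of_ae_le_add (hE _) gradMod_nonneg
      (hcs.ae_gradMod_min_le (hFAC (ns k)) hg)).trans_lt (hfin2 _ _ (hFfin _) hgfin)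
  · have hbound : Tendsto (fun k => (2 * ∫⁻ x, ENNReal.ofReal
        (gradMod G ℓ em (fun y => F (ns k) y - f y) x ^ 2) ∂μ +
        2 * ∫⁻ x, ENNReal.ofReal ((if F (ns k) x < g x ↔ f x < g x then 0
          else gradMod G ℓ em (fun y => f y - g y) x) ^ 2) ∂μ) +
        ∫⁻ x, ENNReal.ofReal ((F (ns k) x - f x) ^ 2) ∂μ) atTop (𝓝 0) := by
      simpa using ((ENNReal.Tendsto.const_mul (hD.comp hns.tendsto_atTop)
        (Or.inr ENNReal.ofNat_ne_top) (a := 2)).add (ENNReal.Tendsto.const_mul hside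
        (Or.inr ENNReal.ofNat_ne_top) (a := 2))).add (hL2.comp hns.tendsto_atTop)
    refine tendsto_of_tendsto_of_tendsto_of_le_of_le tendsto_const_nhds hbound
      (fun _ => zero_le) fun k => add_le_add ?_ ?_
    · rw [hcs.dirEnergy_eq (((hFAC (ns k)).min hg).sub hmin)]
      exact lintegral_ofReal_sq_le_of_ae_le_add (hE _) gradMod_nonneg
        (hcs.ae_gradMod_min_sub_min_le (hFAC (ns k)) hfAC hg)
    · refine lintegral_mono fun x => ENNReal.ofReal_le_ofReal (sq_le_sq.2 ?_)
      simpa using abs_min_sub_min_le_max (F (ns k) x) (g x) (f x) (g x)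

end
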